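/- Let X be a separable geodesic δ-hyperbolic metric space with basepoint x0, and let (h_n) be a sequence of horofunctions in X̄^h converging pointwise to an infinite horofunction h ∈ X̄^h_∞. Then φ(h_n) converges to φ(h) in the Gromov boundary ∂X (where if h_n is a finite horofunction this means x_n → φ(h) for any choice of x_n ∈ φ(h_n)). In particular the local minimum map φ : X̄^h_∞ → ∂X is continuous, and moreover φ : X̄^h_∞ → ∂X is surjective. -/

import Mathlib

open Filter Metric Set Topology

noncomputable section

/-- The Gromov product `(x·y)_p = ½(d(p,x) + d(p,y) − d(x,y))`. -/
def gromovProd {X : Type*} [MetricSpace X] (p x y : X) : ℝ :=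
  (dist p x + dist p y - dist x y) / 2

/-- `f` is a unit-speed geodesic segment from `x` to `y`, parametrized on `[0, d(x,y)]`. -/
def IsGeodesicSegment {X : Type*} [MetricSpace X] (f : ℝ → X) (x y : X) : Prop :=
  f 0 = x ∧ f (dist x y) = y ∧
    ∀ s ∈ Set.Icc (0 : ℝ) (dist x y), ∀ t ∈ Set.Icc (0 : ℝ) (dist x y),
      dist (f s) (f t) = |s - t|

/-- The image of a geodesic segment from `x` to `y`. -/
def geodImage {X : Type*} [MetricSpace X] (f : ℝ → X) (x y : X) : Set X :=
  f '' Set.Icc 0 (dist x y)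

/-- A metric space is geodesic if any two points are joined by a geodesic segment. -/
def GeodesicSpace (X : Type*) [MetricSpace X] : Prop :=
  ∀ x y : X, ∃ f : ℝ → X, IsGeodesicSegment f x y

/-- `X` is `δ`-hyperbolic in the sense of slim triangles: every side of every geodesic
triangle is contained in the `δ`-neighbourhood of the union of the other two sides. -/
def SlimTriangles (δ : ℝ) (X : Type*) [MetricSpace X] : Prop :=
  ∀ (x y z : X) (f g h : ℝ → X), IsGeodesicSegment f x y → IsGeodesicSegment g y z →
    IsGeodesicSegment h x z →
      ∀ p ∈ geodImage f x y, Metric.infDist p (geodImage g y z ∪ geodImage h x z) ≤ δ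

/-- The shadow `S_{x0}(x, R) = { y : (x·y)_{x0} ≥ d(x0,x) − R }`. -/
def shadow {X : Type*} [MetricSpace X] (x0 x : X) (R : ℝ) : Set X :=
  {y | dist x0 x - R ≤ gromovProd x0 x y}

/-- A `(Q,c)`-quasigeodesic, parametrized on the set `s ⊆ ℝ`. -/
def IsQuasigeodesicOn {X : Type*} [MetricSpace X] (Q c : ℝ) (f : ℝ → X) (s : Set ℝ) : Prop :=
  ∀ u ∈ s, ∀ v ∈ s,
    (1 / Q) * |u - v| - c ≤ dist (f u) (f v) ∧ dist (f u) (f v) ≤ Q * |u - v| + c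

end

/-- The horofunction `ρ_y(z) = d(z,y) − d(x0,y)` associated to the point `y`, with
basepoint `x0`. -/
def horo {X : Type*} [MetricSpace X] (x0 y : X) : X → ℝ :=
  fun z => dist z y - dist x0 y

/-- The horofunction compactification of `X` (with basepoint `x0`): the closure of the
set of horofunctions `ρ_y`, `y ∈ X`, inside `X → ℝ` with the topology of pointwise
convergence. -/
def horoCpt {X : Type*} [MetricSpace X] (x0 : X) : Set (X → ℝ) :=
  closure (Set.range (horo x0))

/-- `u` is a Gromov sequence: `(u_m · u_n)_{x0} → ∞` as `min(m,n) → ∞`. -/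
def IsGromovSeq {X : Type*} [MetricSpace X] (x0 : X) (u : ℕ → X) : Prop :=
  Filter.Tendsto (fun p : ℕ × ℕ => gromovProd x0 (u p.1) (u p.2))
    (Filter.atTop ×ˢ Filter.atTop) Filter.atTop

/-- The type of Gromov sequences in `X` (with basepoint `x0`). -/
def GromovSeq (X : Type*) [MetricSpace X] (x0 : X) : Type _ :=
  {u : ℕ → X // IsGromovSeq x0 u}

/-- Two Gromov sequences are equivalent when `(u_n · v_n)_{x0} → ∞`. -/
def gromovRel {X : Type*} [MetricSpace X] (x0 : X) (u v : GromovSeq X x0) : Prop :=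
  Filter.Tendsto (fun n => gromovProd x0 (u.1 n) (v.1 n)) Filter.atTop Filter.atTop

/-- The Gromov boundary `∂X`: equivalence classes of Gromov sequences. -/
def GromovBoundary (X : Type*) [MetricSpace X] (x0 : X) : Type _ :=
  Quot (gromovRel x0)

/-- A sequence of points of `X` converges (in `X ∪ ∂X`) to the boundary point `ξ ∈ ∂X`:
it is a Gromov sequence whose class is `ξ`. -/
def SeqConvergesTo {X : Type*} [MetricSpace X] (x0 : X) (u : ℕ → X)
    (ξ : GromovBoundary X x0) : Prop :=
  ∃ hu : IsGromovSeq x0 u, Quot.mk (gromovRel x0) ⟨u, hu⟩ = ξ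

theorem gromovProd_comm {X : Type*} [MetricSpace X] (p x y : X) :
    gromovProd p x y = gromovProd p y x := by
  unfold gromovProd
  rw [dist_comm x y]
  ring

theorem gromovProd_le_dist_left {X : Type*} [MetricSpace X] (p x y : X) :
    gromovProd p x y ≤ dist p x := by
  have := dist_triangle p x y
  unfold gromovProd
  linarith

theorem IsGeodesicSegment.dist_left {X : Type*} [MetricSpace X] {f : ℝ → X} {x y : X}
    (hf : IsGeodesicSegment f x y) {t : ℝ} (ht : t ∈ Set.Icc 0 (dist x y)) :
    dist x (f t) = t := by
  have h := hf.2.2 0 ⟨le_rfl, dist_nonneg⟩ t ht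
  rwa [hf.1, zero_sub, abs_neg, abs_of_nonneg ht.1] at h

theorem IsGeodesicSegment.dist_right {X : Type*} [MetricSpace X] {f : ℝ → X} {x y : X}
    (hf : IsGeodesicSegment f x y) {t : ℝ} (ht : t ∈ Set.Icc 0 (dist x y)) :
    dist (f t) y = dist x y - t := by
  have h := hf.2.2 t ht (dist x y) ⟨dist_nonneg, le_rfl⟩
  rwa [hf.2.1, abs_sub_comm, abs_of_nonneg (sub_nonneg.2 ht.2)] at h

theorem dist_add_dist_of_mem_geodImage {X : Type*} [MetricSpace X] {f : ℝ → X} {x y q : X}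
    (hf : IsGeodesicSegment f x y) (hq : q ∈ geodImage f x y) :
    dist x q + dist q y = dist x y := by
  obtain ⟨t, ht, rfl⟩ := hq
  rw [hf.dist_left ht, hf.dist_right ht]
  ring

/-- The Gromov product is at most the distance to any point of a geodesic. -/
theorem gromovProd_le_dist_of_mem_geodImage {X : Type*} [MetricSpace X] {f : ℝ → X}
    {x y q : X} (p : X) (hf : IsGeodesicSegment f x y) (hq : q ∈ geodImage f x y) :
    gromovProd p x y ≤ dist p q := by
  have h := dist_add_dist_of_mem_geodImage hf hq
  have hx := dist_triangle p q x
  have hy := dist_triangle p q y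
  rw [dist_comm q x] at hx
  unfold gromovProd
  linarith

theorem SlimTriangles.exists_dist_lt {X : Type*} [MetricSpace X] {δ : ℝ}
    (hslim : SlimTriangles δ X) {x y z : X} {f g k : ℝ → X} (hf : IsGeodesicSegment f x y)
    (hg : IsGeodesicSegment g y z) (hk : IsGeodesicSegment k x z) {q : X}
    (hq : q ∈ geodImage f x y) :
    ∃ a ∈ geodImage g y z ∪ geodImage k x z, dist q a < δ + 1 := by
  have hne : (geodImage g y z ∪ geodImage k x z).Nonempty :=
    ⟨g 0, Or.inl ⟨0, ⟨le_rfl, dist_nonneg⟩, rfl⟩⟩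
  exact (Metric.infDist_lt_iff hne).1 ((hslim x y z f g k hf hg hk q hq).trans_lt (lt_add_one δ))

/-- A geodesic passes close to the base point, up to the Gromov product of its endpoints. -/
theorem SlimTriangles.exists_dist_le_gromovProd {X : Type*} [MetricSpace X] {δ : ℝ}
    (hgeo : GeodesicSpace X) (hslim : SlimTriangles δ X) (p : X) {x y : X} {f : ℝ → X}
    (hf : IsGeodesicSegment f x y) :
    ∃ q ∈ geodImage f x y, dist p q ≤ gromovProd p x y + 2 * (δ + 1) := by
  have hxy := dist_triangle p x y
  have hyx := dist_triangle p y x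
  have hpxy := dist_triangle x p y
  rw [dist_comm y x] at hyx
  rw [dist_comm x p] at hpxy
  have ht : (dist x y + dist p x - dist p y) / 2 ∈ Set.Icc 0 (dist x y) := by
    constructor <;> linarith
  set q := f ((dist x y + dist p x - dist p y) / 2)
  have hq : q ∈ geodImage f x y := ⟨_, ht, rfl⟩
  have hqx : dist x q = _ := hf.dist_left ht
  have hqy : dist q y = _ := hf.dist_right ht
  obtain ⟨g, hg⟩ := hgeo y p
  obtain ⟨k, hk⟩ := hgeo x p
  refine ⟨q, hq, ?_⟩
  obtain ⟨a, ha, hqa⟩ := hslim.exists_dist_lt hf hg hk hq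
  have hp := dist_triangle p a q
  rw [dist_comm a q, dist_comm p a] at hp
  unfold gromovProd
  rcases ha with ha | ha
  · have h := dist_add_dist_of_mem_geodImage hg ha
    have hy := dist_triangle q a y
    rw [dist_comm a y] at hy
    rw [dist_comm y p] at h
    linarith
  · have h := dist_add_dist_of_mem_geodImage hk ha
    have hx := dist_triangle x a q
    rw [dist_comm a q] at hx
    rw [dist_comm x p] at h
    linarith

/-- Slim triangles imply the four point inequality for Gromov products. -/
theorem SlimTriangles.min_gromovProd_le {X : Type*} [MetricSpace X] {δ : ℝ}
    (hgeo : GeodesicSpace X) (hslim : SlimTriangles δ X) (p x y z : X) :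
    min (gromovProd p x y) (gromovProd p y z) - 3 * (δ + 1) ≤ gromovProd p x z := by
  obtain ⟨f, hf⟩ := hgeo x z
  obtain ⟨g, hg⟩ := hgeo z y
  obtain ⟨k, hk⟩ := hgeo x y
  obtain ⟨q, hq, hpq⟩ := hslim.exists_dist_le_gromovProd hgeo p hf
  obtain ⟨a, ha, hqa⟩ := hslim.exists_dist_lt hf hg hk hq
  have hpa := dist_triangle p q a
  rcases ha with ha | ha
  · have h := gromovProd_le_dist_of_mem_geodImage p hg ha
    rw [gromovProd_comm] at h
    linarith [min_le_right (gromovProd p x y) (gromovProd p y z)]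
  · have h := gromovProd_le_dist_of_mem_geodImage p hk ha
    linarith [min_le_left (gromovProd p x y) (gromovProd p y z)]

theorem neg_horo_le_gromovProd {X : Type*} [MetricSpace X] (x0 x z : X) :
    -horo x0 z x ≤ gromovProd x0 x z := by
  have := dist_triangle x0 x z
  unfold horo gromovProd
  linarith

/-- Two points deep inside horoballs of the same horofunction have large Gromov product. -/
theorem min_neg_le_gromovProd_of_mem_horoCpt {X : Type*} [MetricSpace X] {x0 : X} {C : ℝ}
    (hC : ∀ x y z : X, min (gromovProd x0 x y) (gromovProd x0 y z) - C ≤ gromovProd x0 x z)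
    {h : X → ℝ} (hh : h ∈ horoCpt x0) (x y : X) :
    min (-h x) (-h y) - C ≤ gromovProd x0 x y := by
  have hclosed : IsClosed {k : X → ℝ | min (-k x) (-k y) - C ≤ gromovProd x0 x y} :=
    isClosed_le (by fun_prop) continuous_const
  refine closure_minimal ?_ hclosed hh
  rintro _ ⟨z, rfl⟩
  refine le_trans (sub_le_sub_right (min_le_min ?_ ?_) C) (hC x z y)
  · exact neg_horo_le_gromovProd x0 x z
  · rw [gromovProd_comm]
    exact neg_horo_le_gromovProd x0 y z

/-- A sequence is a Gromov sequence equivalent to a given Gromov sequence as soon as, at every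
scale, both eventually have large Gromov product with a common point. -/
theorem seqConvergesTo_of_forall_exists {X : Type*} [MetricSpace X] {x0 : X} {C : ℝ}
    (hC : ∀ x y z : X, min (gromovProd x0 x y) (gromovProd x0 y z) - C ≤ gromovProd x0 x z)
    {u v : ℕ → X} (hu : IsGromovSeq x0 u)
    (huv : ∀ M : ℝ, ∃ p : X, (∀ᶠ n in atTop, M ≤ gromovProd x0 (u n) p) ∧
      ∀ᶠ n in atTop, M ≤ gromovProd x0 (v n) p) :
    SeqConvergesTo x0 v (Quot.mk (gromovRel x0) ⟨u, hu⟩) := by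
  have key : ∀ {M : ℝ} {a b p : X}, M + C ≤ gromovProd x0 a p → M + C ≤ gromovProd x0 b p →
      M ≤ gromovProd x0 a b := by
    intro M a b p ha hb
    rw [gromovProd_comm] at hb
    linarith [hC a p b, le_min ha hb]
  have hv : IsGromovSeq x0 v := by
    refine tendsto_atTop.2 fun M => ?_
    obtain ⟨p, -, hp⟩ := huv (M + C)
    filter_upwards [hp.prod_mk hp] with n hn using key hn.1 hn.2
  refine ⟨hv, Quot.sound (tendsto_atTop.2 fun M => ?_)⟩
  obtain ⟨p, hpu, hpv⟩ := huv (M + C)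
  filter_upwards [hpu, hpv] with n hn hn' using key hn' hn

theorem exists_lt_of_not_bddBelow_range {α : Type*} {h : α → ℝ}
    (hh : ¬ BddBelow (Set.range h)) (M : ℝ) : ∃ y, h y < M := by
  by_contra! hM
  exact hh ⟨M, Set.forall_mem_range.2 hM⟩

/-- Horofunctions along any sequence of points subconverge (along an ultrafilter) in the
horofunction compactification. -/
theorem exists_tendsto_horo_hyperfilter {X : Type*} [MetricSpace X] (x0 : X) (u : ℕ → X) :
    ∃ h ∈ horoCpt x0, Tendsto (fun n => horo x0 (u n)) (hyperfilter ℕ : Filter ℕ) (𝓝 h) := by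
  have hK : IsCompact (Set.univ.pi fun z : X => Set.Icc (-dist z x0) (dist z x0)) :=
    isCompact_univ_pi fun _ => isCompact_Icc
  have hmem : ∀ n, horo x0 (u n) ∈ Set.univ.pi fun z : X => Set.Icc (-dist z x0) (dist z x0) := by
    intro n z _
    exact abs_le.1 (abs_dist_sub_le z x0 (u n))
  obtain ⟨h, -, hh⟩ := hK.ultrafilter_le_nhds ((hyperfilter ℕ).map fun n => horo x0 (u n))
    (le_principal_iff.2 (Ultrafilter.mem_map.2 (univ_mem' hmem)))
  exact ⟨h, mem_closure_of_tendsto hh (Eventually.of_forall fun n => ⟨u n, rfl⟩), hh⟩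

/-- Limits of the horofunctions of a Gromov sequence are very negative at points which have
large Gromov product with the sequence. -/
theorem IsGromovSeq.exists_le_gromovProd_and_le {X : Type*} [MetricSpace X] {x0 : X} {C : ℝ}
    (hgeo : GeodesicSpace X)
    (hC : ∀ x y z : X, min (gromovProd x0 x y) (gromovProd x0 y z) - C ≤ gromovProd x0 x z)
    {u : ℕ → X} (hu : IsGromovSeq x0 u) {h : X → ℝ}
    (hh : Tendsto (fun n => horo x0 (u n)) (hyperfilter ℕ : Filter ℕ) (𝓝 h)) (M : ℝ) :
    ∃ p : X, (∀ᶠ n in atTop, M ≤ gromovProd x0 (u n) p) ∧ h p ≤ -M := by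
  have hC0 : 0 ≤ C := by simpa [gromovProd] using hC x0 x0 x0
  set t := max M 0 + 2 * C
  have ht0 : 0 ≤ t := by positivity
  have hMt : M ≤ t - 2 * C := by simp [t]
  obtain ⟨N, hN⟩ := eventually_atTop.1 (prod_atTop_atTop_eq (α := ℕ) (β := ℕ) ▸
    tendsto_atTop.1 hu t)
  have hN' : ∀ n ≥ N.1 + N.2, t ≤ gromovProd x0 (u (N.1 + N.2)) (u n) := fun n hn =>
    hN (_, n) ⟨Nat.le_add_right _ _, (Nat.le_add_left _ _).trans hn⟩
  set m := N.1 + N.2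
  have htm : t ∈ Set.Icc 0 (dist x0 (u m)) :=
    ⟨ht0, (hN' m le_rfl).trans (gromovProd_le_dist_left _ _ _)⟩
  obtain ⟨f, hf⟩ := hgeo x0 (u m)
  have hx0p := hf.dist_left htm
  have hpm : gromovProd x0 (f t) (u m) = t := by
    unfold gromovProd
    rw [hx0p, hf.dist_right htm]
    ring
  have hp : ∀ n ≥ m, t - C ≤ gromovProd x0 (f t) (u n) := fun n hn => by
    linarith [hC (f t) (u m) (u n), le_min hpm.ge (hN' n hn)]
  refine ⟨f t, ?_, ?_⟩
  · filter_upwards [eventually_ge_atTop m] with n hn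
    rw [gromovProd_comm]
    linarith [hp n hn]
  · refine le_of_tendsto (tendsto_pi_nhds.1 hh (f t)) ?_
    filter_upwards [Nat.hyperfilter_le_atTop (eventually_ge_atTop m)] with n hn
    have h := hp n hn
    unfold gromovProd at h
    unfold horo
    linarith

/-- continuity and surjectivity of the local minimum map. Let `X` be a
separable geodesic `δ`-hyperbolic space with basepoint `x0`.  Let `(h_n)` be a sequence in
the horofunction compactification converging pointwise to an infinite horofunction `h`,
and let `ξ = φ(h)` be the boundary point to which every minimizing sequence of `h`
converges.  Then `φ(h_n) → ξ`: any choice of points `x_n ∈ φ(h_n)` (namely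
`h_n(x_n) ≤ inf h_n + 1` when `h_n` is a finite horofunction, and `h_n(x_n) ≤ −n` when
`h_n` is infinite) converges to `ξ` in `∂X`.  In particular the local minimum map
`φ : X̄^h_∞ → ∂X` is continuous; moreover it is surjective. -/
theorem local_minimum_map_continuous_surjective
    {X : Type*} [MetricSpace X] [TopologicalSpace.SeparableSpace X] {δ : ℝ} (hδ : 0 ≤ δ)
    (hgeo : GeodesicSpace X) (hslim : SlimTriangles δ X) (x0 : X) :
    (∀ (hseq : ℕ → (X → ℝ)) (h : X → ℝ), (∀ n, hseq n ∈ horoCpt x0) → h ∈ horoCpt x0 →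
      Filter.Tendsto hseq Filter.atTop (nhds h) →
      ¬ BddBelow (Set.range h) →
      ∀ ξ : GromovBoundary X x0,
        (∀ u : ℕ → X, Filter.Tendsto (fun n => h (u n)) Filter.atTop Filter.atBot →
          SeqConvergesTo x0 u ξ) →
        ∀ x : ℕ → X,
          (∀ n : ℕ,
            (BddBelow (Set.range (hseq n)) → hseq n (x n) ≤ (⨅ z : X, hseq n z) + 1) ∧
            (¬ BddBelow (Set.range (hseq n)) → hseq n (x n) ≤ -(n : ℝ))) →
          SeqConvergesTo x0 x ξ) ∧
    ∀ ξ : GromovBoundary X x0, ∃ h ∈ horoCpt x0, ¬ BddBelow (Set.range h) ∧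
      ∀ u : ℕ → X, Filter.Tendsto (fun n => h (u n)) Filter.atTop Filter.atBot →
        SeqConvergesTo x0 u ξ := by
  have hC := hslim.min_gromovProd_le hgeo x0
  refine ⟨?_, ?_⟩
  · intro hseq h hseq_mem h_mem hlim h_inf ξ hξ x hx
    choose y hy using fun n : ℕ => exists_lt_of_not_bddBelow_range h_inf (-(n : ℝ))
    have hy_lim : Tendsto (fun n => h (y n)) atTop atBot :=
      tendsto_atBot_mono (fun n => (hy n).le)
        (tendsto_neg_atTop_atBot.comp tendsto_natCast_atTop_atTop)
    obtain ⟨hyG, rfl⟩ := hξ y hy_lim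
    refine seqConvergesTo_of_forall_exists hC hyG fun M => ?_
    obtain ⟨p, hp⟩ := exists_lt_of_not_bddBelow_range h_inf (-(M + 3 * (δ + 1)) - 1)
    have hp_lim : ∀ᶠ n in atTop, hseq n p < -(M + 3 * (δ + 1)) - 1 :=
      (tendsto_pi_nhds.1 hlim p).eventually (gt_mem_nhds hp)
    refine ⟨p, ?_, ?_⟩
    · filter_upwards [tendsto_atBot.1 hy_lim (-(M + 3 * (δ + 1)))] with n hn
      have hmin : M + 3 * (δ + 1) ≤ min (-h (y n)) (-h p) := le_min (by linarith) (by linarith)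
      linarith [min_neg_le_gromovProd_of_mem_horoCpt hC h_mem (y n) p]
    · filter_upwards [hp_lim,
        tendsto_natCast_atTop_atTop.eventually_ge_atTop (M + 3 * (δ + 1))] with n hn hnM
      have hxn : hseq n (x n) ≤ -(M + 3 * (δ + 1)) := by
        by_cases hb : BddBelow (Set.range (hseq n))
        · linarith [(hx n).1 hb, ciInf_le hb p]
        · linarith [(hx n).2 hb]
      have hmin : M + 3 * (δ + 1) ≤ min (-hseq n (x n)) (-hseq n p) :=
        le_min (by linarith) (by linarith)
      linarith [min_neg_le_gromovProd_of_mem_horoCpt hC (hseq_mem n) (x n) p]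
  · rintro ⟨u, hu⟩
    obtain ⟨h, h_mem, hh⟩ := exists_tendsto_horo_hyperfilter x0 u
    refine ⟨h, h_mem, ?_, fun v hv => ?_⟩
    · rintro ⟨b, hb⟩
      obtain ⟨p, -, hp⟩ := hu.exists_le_gromovProd_and_le hgeo hC hh (1 - b)
      linarith [hb ⟨p, rfl⟩]
    · refine seqConvergesTo_of_forall_exists hC hu fun M => ?_
      obtain ⟨p, hpu, hp⟩ := hu.exists_le_gromovProd_and_le hgeo hC hh (M + 3 * (δ + 1))
      refine ⟨p, ?_, ?_⟩
      · filter_upwards [hpu] with n hn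
        linarith
      · filter_upwards [tendsto_atBot.1 hv (-(M + 3 * (δ + 1)))] with n hn
        have hmin : M + 3 * (δ + 1) ≤ min (-h (v n)) (-h p) :=
          le_min (by linarith) (by linarith)
        linarith [min_neg_le_gromovProd_of_mem_horoCpt hC h_mem (v n) p]
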